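/- Zar_h(R), endowed with the Zariski topology, is homeomorphic to Spec(KR(R,b)) endowed with the Zariski topology; in particular, Zar_h(R) is a spectral space. -/

import Mathlib

open Pointwise

section
/- `Γ` is a nonzero torsionless (i.e. admitting a compatible total order) cancellative
commutative monoid, `A` is an integral domain graded by `Γ` via `𝒜`, with quotient
field `K`. -/
variable {Γ : Type*} [AddCommMonoid Γ] [LinearOrder Γ]
  [CovariantClass Γ Γ (· + ·) (· < ·)] [Nontrivial Γ]
variable {A : Type*} [CommRing A] [IsDomain A]
variable {K : Type*} [Field K] [Algebra A K] [IsFractionRing A K]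

instance : SMulCommClass K A K := SMulCommClass.symm A K K

variable (𝒜 : Γ → AddSubgroup A) [GradedRing 𝒜]

/-- `a` is a nonzero homogeneous element of the graded domain `A`. -/
def IsHomog (a : A) : Prop := a ≠ 0 ∧ ∃ γ : Γ, a ∈ 𝒜 γ

/-- `x ∈ K` is a (nonzero) homogeneous element of the homogeneous quotient ring `R_H`,
i.e. `x = a/s` with `a` a nonzero homogeneous element and `s ∈ H`. -/
def IsHomogElem (x : K) : Prop :=
  ∃ a s : A, IsHomog 𝒜 a ∧ IsHomog 𝒜 s ∧ x * algebraMap A K s = algebraMap A K a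

/-- `x ∈ K` belongs to the homogeneous quotient ring `R_H`. -/
def MemRH (x : K) : Prop :=
  ∃ a s : A, IsHomog 𝒜 s ∧ x * algebraMap A K s = algebraMap A K a

/-- The image in `K` of an integral ideal of `A`. -/
def idealToK (I : Ideal A) : Submodule A K := Submodule.map (Algebra.linearMap A K) I

/-- `E` is a homogeneous fractional ideal of `A`: `sE` is (the image in `K` of) a
homogeneous integral ideal for some nonzero homogeneous `s`. -/
def IsHomogFrac (E : Submodule A K) : Prop :=
  ∃ s : A, IsHomog 𝒜 s ∧ ∃ I : Ideal A, Ideal.IsHomogeneous 𝒜 I ∧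
    algebraMap A K s • E = idealToK (K := K) I

/-- The four axioms of a semistar operation, imposed on nonzero `A`-submodules of `K`. -/
def IsSemistar (star : Submodule A K → Submodule A K) : Prop :=
  (∀ x : K, x ≠ 0 → ∀ E : Submodule A K, E ≠ ⊥ → star (x • E) = x • star E) ∧
  (∀ E F : Submodule A K, E ≠ ⊥ → E ≤ F → star E ≤ star F) ∧
  (∀ E : Submodule A K, E ≠ ⊥ → E ≤ star E) ∧
  (∀ E : Submodule A K, E ≠ ⊥ → star (star E) = star E)

/-- `star` is homogeneous preserving. -/
def HomogPres (star : Submodule A K → Submodule A K) : Prop :=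
  ∀ E : Submodule A K, E ≠ ⊥ → IsHomogFrac 𝒜 E → IsHomogFrac 𝒜 (star E)

/-- Membership in `E^{⋆_f} = ⋃ {F^⋆ : F nonzero finitely generated, F ⊆ E}`. -/
def MemStarF (star : Submodule A K → Submodule A K) (E : Submodule A K) (x : K) : Prop :=
  ∃ F : Submodule A K, F ≠ ⊥ ∧ F.FG ∧ F ≤ E ∧ x ∈ star F

/-- `star` is of finite type, i.e. `⋆ = ⋆_f`. -/
def IsFiniteType (star : Submodule A K → Submodule A K) : Prop :=
  ∀ E : Submodule A K, E ≠ ⊥ → ∀ x : K, x ∈ star E ↔ MemStarF star E x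

/-- Membership in `E^{⋆_a}`:  `F^{⋆_a} = ⋃ {((FG)^⋆ : G^⋆) : G nonzero f.g.}` for f.g. `F`,
and `E^{⋆_a} = ⋃ {F^{⋆_a} : F ⊆ E nonzero f.g.}`. -/
def MemStarA (star : Submodule A K → Submodule A K) (E : Submodule A K) (x : K) : Prop :=
  ∃ F : Submodule A K, F ≠ ⊥ ∧ F.FG ∧ F ≤ E ∧
    ∃ G : Submodule A K, G ≠ ⊥ ∧ G.FG ∧ ∀ y ∈ star G, x * y ∈ star (F * G)

/-- Membership in `E^{⋆_{a(h)}}`: as in `⋆_a` but with `G` ranging over nonzero finitely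
generated *homogeneous* fractional ideals. -/
def MemStarAH (star : Submodule A K → Submodule A K) (E : Submodule A K) (x : K) : Prop :=
  ∃ F : Submodule A K, F ≠ ⊥ ∧ F.FG ∧ F ≤ E ∧
    ∃ G : Submodule A K, G ≠ ⊥ ∧ G.FG ∧ IsHomogFrac 𝒜 G ∧ ∀ y ∈ star G, x * y ∈ star (F * G)

/-- `star` is graded-e.a.b. -/
def IsGrEab (star : Submodule A K → Submodule A K) : Prop :=
  ∀ E F G : Submodule A K,
    E ≠ ⊥ → E.FG → IsHomogFrac 𝒜 E →
    F ≠ ⊥ → F.FG → IsHomogFrac 𝒜 F →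
    G ≠ ⊥ → G.FG → IsHomogFrac 𝒜 G →
    star (E * F) ≤ star (E * G) → star F ≤ star G

/-- The `A`-submodule of `K` generated by all products `e * v`, `e ∈ E`, `v ∈ S`
(e.g. `EV` for an overring `V`). -/
def mulSet (E : Submodule A K) (S : Set K) : Submodule A K :=
  Submodule.span A {z : K | ∃ e ∈ E, ∃ v ∈ S, z = e * v}

/-- The `b`-operation: `E^b = ⋂ {EV : V a valuation overring of A}`. -/
def bOp : Submodule A K → Submodule A K := fun E =>
  ⨅ (V : ValuationSubring K) (_ : ∀ a : A, algebraMap A K a ∈ V), mulSet E (V : Set K)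

/-- The image of a polynomial over `A` in the rational function field `K(X)`. -/
noncomputable def polyToRatFunc (f : Polynomial A) : RatFunc K :=
  algebraMap (Polynomial K) (RatFunc K) (Polynomial.map (algebraMap A K) f)

/-- The content ideal `c(f)` of a polynomial. -/
def contentIdeal (f : Polynomial A) : Ideal A := Ideal.span (Set.range f.coeff)

/-- The homogeneous content ideal `𝒜_f`, generated by all homogeneous components of all
coefficients of `f`. -/
def homogContentIdeal (f : Polynomial A) : Ideal A :=
  Ideal.span {a : A | ∃ (n : ℕ) (γ : Γ), a = (DirectSum.decompose 𝒜 (f.coeff n) γ : A)}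

/-- The Kronecker function ring `Kr(R,⋆)` as a subset of `K(X)`. -/
def KrSet (star : Submodule A K → Submodule A K) : Set (RatFunc K) :=
  {q | ∃ f g h : Polynomial A, g ≠ 0 ∧ h ≠ 0 ∧
    q * polyToRatFunc (K := K) g = polyToRatFunc (K := K) f ∧
    idealToK (contentIdeal f * contentIdeal h) ≤ star (idealToK (contentIdeal g * contentIdeal h))}

/-- The homogeneous Kronecker function ring `KR(R,⋆)` as a subset of `K(X)`. -/
def KRSet (star : Submodule A K → Submodule A K) : Set (RatFunc K) :=
  {q | ∃ f g h : Polynomial A, g ≠ 0 ∧ h ≠ 0 ∧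
    q * polyToRatFunc (K := K) g = polyToRatFunc (K := K) f ∧
    idealToK (homogContentIdeal 𝒜 f * homogContentIdeal 𝒜 h) ≤
      star (idealToK (homogContentIdeal 𝒜 g * homogContentIdeal 𝒜 h))}

/-- `V` is a homogeneous overring of `A`: `R ⊆ V ⊆ R_H` and `V` is generated as an
additive group by its homogeneous elements. -/
def IsHomogOverring (V : Subring K) : Prop :=
  (∀ a : A, algebraMap A K a ∈ V) ∧ (∀ x ∈ V, MemRH 𝒜 x) ∧
  (∀ v ∈ V, v ∈ AddSubgroup.closure {x : K | x ∈ V ∧ IsHomogElem 𝒜 x})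

/-- `V` is a gr-valuation overring of `A`. -/
def IsGrValOverring (V : Subring K) : Prop :=
  IsHomogOverring 𝒜 V ∧ ∀ x : K, IsHomogElem 𝒜 x → x ∈ V ∨ x⁻¹ ∈ V

/-- `V` is a gr-`⋆`-valuation overring of `A`: `F^⋆ ⊆ FV` for every nonzero finitely
generated homogeneous fractional ideal `F`. -/
def IsGrStarValOverring (star : Submodule A K → Submodule A K) (V : Subring K) : Prop :=
  ∀ F : Submodule A K, F ≠ ⊥ → F.FG → IsHomogFrac 𝒜 F → star F ≤ mulSet F (V : Set K)

end

/-- A spectral space: quasi-compact, `T0`, the quasi-compact open subsets are closed under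
finite intersection and form an open basis, and every nonempty irreducible closed subset
has a generic point (= quasi-sober). -/
def IsSpectralSpace (X : Type*) [TopologicalSpace X] : Prop :=
  CompactSpace X ∧ T0Space X ∧ QuasiSober X ∧
  (∀ U V : Set X, IsOpen U → IsCompact U → IsOpen V → IsCompact V → IsCompact (U ∩ V)) ∧
  TopologicalSpace.IsTopologicalBasis {U : Set X | IsOpen U ∧ IsCompact U}

section ZarSpaces
variable {Γ : Type*} [AddCommMonoid Γ] [LinearOrder Γ]
  [CovariantClass Γ Γ (· + ·) (· < ·)] [Nontrivial Γ]
  {A : Type*} [CommRing A] [IsDomain A]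
  (K : Type*) [Field K] [Algebra A K] [IsFractionRing A K]
  (𝒜 : Γ → AddSubgroup A) [GradedRing 𝒜]

/-- `Zar_h(R)`: the set of gr-valuation overrings of `R`. -/
abbrev ZarH := {V : Subring K // IsGrValOverring 𝒜 V}

/-- The Zariski topology on `Zar_h(R)`, with subbasic open sets `{V : u ∈ V}` for `u`
a homogeneous element of `R_H`. -/
instance : TopologicalSpace (ZarH K 𝒜) :=
  TopologicalSpace.generateFrom
    {S : Set (ZarH K 𝒜) | ∃ u : K, IsHomogElem 𝒜 u ∧ S = {V | u ∈ V.1}}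

end ZarSpaces

set_option linter.unusedSectionVars false

section Gauss
variable {M : Type*}
variable {B : Type*} [CommRing B] {Γ₀ : Type*} [LinearOrderedCommGroupWithZero Γ₀]

/-- The Gauss sup of a valuation over the coefficients of an element of a monoid algebra. -/
def gaussSup (v : Valuation B Γ₀) (f : AddMonoidAlgebra B M) : Γ₀ :=
  f.coeff.support.sup fun i => v (f.coeff i)

theorem le_gaussSup (v : Valuation B Γ₀) (f : AddMonoidAlgebra B M) (i : M) :
    v (f.coeff i) ≤ gaussSup v f := by
  by_cases h : f.coeff i = 0
  · simp [h]
  · exact Finset.le_sup (f := fun i => v (f.coeff i)) (Finsupp.mem_support_iff.2 h)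

theorem gaussSup_le (v : Valuation B Γ₀) (f : AddMonoidAlgebra B M) {r : Γ₀}
    (h : ∀ i, v (f.coeff i) ≤ r) : gaussSup v f ≤ r :=
  Finset.sup_le fun i _ => h i

theorem exists_last_gaussSup [LinearOrder M] (v : Valuation B Γ₀) (f : AddMonoidAlgebra B M)
    (hf : gaussSup v f ≠ 0) :
    ∃ i, v (f.coeff i) = gaussSup v f ∧ ∀ j, i < j → v (f.coeff j) < gaussSup v f := by
  have hne : f.coeff.support.Nonempty := by
    rw [Finset.nonempty_iff_ne_empty]
    intro h
    exact hf (by simp [gaussSup, h, bot_eq_zero])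
  obtain ⟨i, hi, hi'⟩ := Finset.exists_mem_eq_sup _ hne (fun i => v (f.coeff i))
  set s := f.coeff.support.filter fun i => v (f.coeff i) = gaussSup v f
  have hs : s.Nonempty := ⟨i, Finset.mem_filter.2 ⟨hi, hi'.symm⟩⟩
  refine ⟨s.max' hs, (Finset.mem_filter.1 (s.max'_mem hs)).2, fun j hj => ?_⟩
  refine lt_of_le_of_ne (le_gaussSup v f j) fun h => ?_
  have hj0 : f.coeff j ≠ 0 := fun h0 => hf (by rw [← h, h0, map_zero])
  exact absurd (s.le_max' j (Finset.mem_filter.2 ⟨Finsupp.mem_support_iff.2 hj0, h⟩)) hj.not_ge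

theorem exists_eq_gaussSup [Nonempty M] (v : Valuation B Γ₀) (f : AddMonoidAlgebra B M) :
    ∃ i, v (f.coeff i) = gaussSup v f := by
  rcases f.coeff.support.eq_empty_or_nonempty with h | h
  · refine ⟨Classical.arbitrary M, le_antisymm (le_gaussSup v f _) ?_⟩
    simp [gaussSup, h, bot_eq_zero]
  · obtain ⟨i, -, hi⟩ := Finset.exists_mem_eq_sup _ h (fun i => v (f.coeff i))
    exact ⟨i, hi.symm⟩

variable [AddCommMonoid M] [LinearOrder M] [CovariantClass M M (· + ·) (· < ·)]

theorem gaussSup_mul (v : Valuation B Γ₀) (f g : AddMonoidAlgebra B M) :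
    gaussSup v (f * g) = gaussSup v f * gaussSup v g := by
  classical
  have hcoeff (k : M) : (f * g).coeff k = ∑ p ∈ f.coeff.support ×ˢ g.coeff.support,
      if p.1 + p.2 = k then f.coeff p.1 * g.coeff p.2 else 0 := by
    rw [AddMonoidAlgebra.coeff_mul, Finset.sum_product]
    rfl
  apply le_antisymm
  · refine gaussSup_le _ _ fun k => ?_
    rw [hcoeff]
    refine v.map_sum_le fun p _ => ?_
    split_ifs
    · rw [map_mul]
      exact mul_le_mul' (le_gaussSup v f _) (le_gaussSup v g _)
    · simp
  · by_cases hf : gaussSup v f = 0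
    · simp [hf]
    by_cases hg : gaussSup v g = 0
    · simp [hg]
    obtain ⟨i, hi, hi'⟩ := exists_last_gaussSup v f hf
    obtain ⟨j, hj, hj'⟩ := exists_last_gaussSup v g hg
    have hne : v (f.coeff i * g.coeff j) ≠ 0 := by rw [map_mul, hi, hj]; exact mul_ne_zero hf hg
    have hmem : (i, j) ∈ f.coeff.support ×ˢ g.coeff.support := by
      have : f.coeff i * g.coeff j ≠ 0 := fun h => hne (by rw [h, map_zero])
      simp only [Finset.mem_product, Finsupp.mem_support_iff]
      exact ⟨left_ne_zero_of_mul this, right_ne_zero_of_mul this⟩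
    have key : v ((f * g).coeff (i + j)) = v (f.coeff i * g.coeff j) := by
      rw [hcoeff, ← Finset.add_sum_erase _ _ hmem, if_pos rfl]
      apply v.map_add_eq_of_lt_left
      refine v.map_sum_lt hne fun p hp => ?_
      split_ifs with h
      · rw [map_mul, map_mul, hi, hj]
        rcases lt_trichotomy p.1 i with hlt | heq | hgt
        · have h2 : j < p.2 := by
            by_contra hle
            rw [not_lt] at hle
            have h1 : p.1 + p.2 < i + j := by
              have h3 : p.1 + p.2 ≤ p.1 + j := by
                rcases hle.lt_or_eq with hh | hh
                · exact (CovariantClass.elim p.1 hh).le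
                · rw [hh]
              have h4 : j + p.1 < j + i := CovariantClass.elim j hlt
              rw [add_comm j, add_comm j] at h4
              exact h3.trans_lt h4
            exact h1.ne h
          exact mul_lt_mul_of_le_of_lt_of_nonneg_of_pos (le_gaussSup v f _) (hj' _ h2) zero_le
            (zero_lt_iff.2 hf)
        · have h2 : p.2 = j := by
            rw [heq] at h
            rcases lt_trichotomy p.2 j with hh | hh | hh
            · exact absurd h (CovariantClass.elim i hh).ne
            · exact hh
            · exact absurd h (CovariantClass.elim i hh).ne'
          exact absurd (Prod.ext heq h2) (Finset.mem_erase.1 hp).1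
        · exact mul_lt_mul_of_lt_of_le_of_nonneg_of_pos (hi' _ hgt) (le_gaussSup v g _) zero_le
            (zero_lt_iff.2 hg)
      · rw [map_zero]; exact zero_lt_iff.2 hne
    calc _ = v ((f * g).coeff (i + j)) := by rw [key, map_mul, hi, hj]
      _ ≤ _ := le_gaussSup v _ _

/-- The Gauss extension of a valuation to a monoid algebra over an ordered monoid. -/
def gaussVal (v : Valuation B Γ₀) : Valuation (AddMonoidAlgebra B M) Γ₀ where
  toFun := gaussSup v
  map_zero' := by simp [gaussSup, bot_eq_zero]
  map_one' := by
    classical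
    apply le_antisymm
    · refine gaussSup_le _ _ fun i => ?_
      rw [AddMonoidAlgebra.one_def, AddMonoidAlgebra.coeff_single, Finsupp.single_apply]
      split_ifs <;> simp
    · refine le_trans ?_ (le_gaussSup v _ 0)
      simp [AddMonoidAlgebra.one_def]
  map_mul' := gaussSup_mul v
  map_add_le_max' f g := by
    refine gaussSup_le _ _ fun i => ?_
    rw [AddMonoidAlgebra.coeff_add, Finsupp.add_apply]
    exact (v.map_add _ _).trans (max_le_max (le_gaussSup v f i) (le_gaussSup v g i))

end Gauss

section FractionField
open Polynomial
variable {A : Type*} [CommRing A] {K : Type*} [Field K] [Algebra A K]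

attribute [local instance] Polynomial.algebra

theorem algebraMap_eq_polyToRatFunc (f : A[X]) :
    algebraMap A[X] (RatFunc K) f = polyToRatFunc (K := K) f := rfl

theorem isFractionRing_polynomial_ratFunc [IsDomain A] [IsFractionRing A K] :
    IsFractionRing A[X] (RatFunc K) := by
  have hinj : Function.Injective (algebraMap A[X] (RatFunc K)) :=
    (RatFunc.algebraMap_injective K).comp
      (Polynomial.map_injective _ (IsFractionRing.injective A K))
  refine ⟨⟨fun y => ?_, fun z => ?_, fun h => ⟨1, by rw [hinj h]⟩⟩⟩
  · exact IsUnit.mk0 _ fun h => nonZeroDivisors.ne_zero y.2 (hinj (by rw [h, map_zero]))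
  · obtain ⟨p, r, hr, rfl⟩ := IsFractionRing.div_surjective (A := K[X]) z
    obtain ⟨b, hb, hp⟩ := IsLocalization.integerNormalization_spec (nonZeroDivisors A) p
    obtain ⟨c, hc, hq⟩ := IsLocalization.integerNormalization_spec (nonZeroDivisors A) r
    set P := IsLocalization.integerNormalization (nonZeroDivisors A) p
    set Q := IsLocalization.integerNormalization (nonZeroDivisors A) r
    have hr0 : r ≠ 0 := nonZeroDivisors.ne_zero hr
    have hinjA := IsFractionRing.injective A K
    have hb0 : algebraMap A K b ≠ 0 := by
      simpa using (map_ne_zero_iff _ hinjA).2 (nonZeroDivisors.ne_zero hb)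
    have hc0 : algebraMap A K c ≠ 0 := by
      simpa using (map_ne_zero_iff _ hinjA).2 (nonZeroDivisors.ne_zero hc)
    have hP : P.map (algebraMap A K) = C (algebraMap A K b) * p := by
      rw [hp, ← Polynomial.smul_eq_C_mul, algebraMap_smul]
    have hQ : Q.map (algebraMap A K) = C (algebraMap A K c) * r := by
      rw [hq, ← Polynomial.smul_eq_C_mul, algebraMap_smul]
    have hden : C b * Q ≠ 0 := fun h => by
      have h' := congrArg (Polynomial.map (algebraMap A K)) h
      rw [Polynomial.map_mul, Polynomial.map_C, hQ, Polynomial.map_zero] at h'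
      simp [hb0, hc0, hr0] at h'
    refine ⟨(C c * P, ⟨C b * Q, mem_nonZeroDivisors_of_ne_zero hden⟩), ?_⟩
    simp only [algebraMap_eq_polyToRatFunc, polyToRatFunc, Polynomial.map_C, hP, hQ,
      map_mul]
    have hr1 : algebraMap K[X] (RatFunc K) r ≠ 0 :=
      (map_ne_zero_iff _ (RatFunc.algebraMap_injective K)).2 hr0
    field_simp

end FractionField

section HomogGauss
open Polynomial
variable {Γ : Type*} [AddCommMonoid Γ] [LinearOrder Γ]
variable {A : Type*} [CommRing A]
variable (𝒜 : Γ → AddSubgroup A) [GradedRing 𝒜]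

/-- The ring homomorphism `∑ γ, a_γ ↦ ∑ γ, a_γ T^γ` from the direct sum of the pieces of a
grading to the monoid algebra. -/
noncomputable def gradedSumHom : (DirectSum Γ fun i => 𝒜 i) →+* AddMonoidAlgebra A Γ :=
  DirectSum.toSemiring
    (fun i => (AddMonoidAlgebra.singleAddHom i).comp (𝒜 i).subtype)
    (AddMonoidAlgebra.one_def).symm
    (by intro i j a b; simp [AddMonoidAlgebra.single_mul_single])

/-- The ring homomorphism `a ↦ ∑ γ, a_γ T^γ` from a graded ring to its monoid algebra. -/
noncomputable def gradedCoaction : A →+* AddMonoidAlgebra A Γ :=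
  (gradedSumHom 𝒜).comp (DirectSum.decomposeRingEquiv 𝒜).toRingHom

theorem gradedCoaction_coeff (a : A) (γ : Γ) :
    (gradedCoaction 𝒜 a).coeff γ = (DirectSum.decompose 𝒜 a γ : A) := by
  classical
  induction a using DirectSum.Decomposition.inductionOn 𝒜 with
  | zero => simp
  | @homogeneous i m =>
    have h : gradedCoaction 𝒜 (m : A) = AddMonoidAlgebra.single i (m : A) := by
      change gradedSumHom 𝒜 (DirectSum.decompose 𝒜 (m : A)) = _
      rw [DirectSum.decompose_coe]
      exact DirectSum.toAddMonoid_of (β := fun i => 𝒜 i)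
        (fun i => (AddMonoidAlgebra.singleAddHom i).comp (𝒜 i).subtype) i m
    rw [h, DirectSum.decompose_coe, DirectSum.coe_of_apply]
    rw [AddMonoidAlgebra.coeff_single, Finsupp.single_apply]
    split_ifs <;> rfl
  | add a b ha hb =>
    rw [map_add, AddMonoidAlgebra.coeff_add, Finsupp.add_apply, ha, hb, DirectSum.decompose_add,
      DirectSum.add_apply, AddSubgroup.coe_add]

variable [CovariantClass Γ Γ (· + ·) (· < ·)]
variable {Γ₀ : Type*} [LinearOrderedCommGroupWithZero Γ₀]

/-- The homogeneous Gauss extension of a valuation on a graded ring to polynomials: the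
largest value of a homogeneous component of a coefficient. -/
noncomputable def homogGauss (v : Valuation A Γ₀) : Valuation A[X] Γ₀ :=
  (gaussVal (M := ℕ) (gaussVal (M := Γ) v)).comap
    ((Polynomial.toFinsuppIso _).toRingHom.comp (Polynomial.mapRingHom (gradedCoaction 𝒜)))

theorem homogGauss_apply (v : Valuation A Γ₀) (f : A[X]) :
    homogGauss 𝒜 v f = gaussSup (gaussVal (M := Γ) v)
      (Polynomial.toFinsuppIso _ (f.map (gradedCoaction 𝒜))) := rfl

theorem gaussVal_coeff_map (v : Valuation A Γ₀) (f : A[X]) (n : ℕ) :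
    gaussVal (M := Γ) v ((Polynomial.toFinsuppIso _ (f.map (gradedCoaction 𝒜))).coeff n) =
      gaussSup v (gradedCoaction 𝒜 (f.coeff n)) := by
  change gaussSup v ((f.map (gradedCoaction 𝒜)).coeff n) = _
  rw [Polynomial.coeff_map]

theorem le_homogGauss (v : Valuation A Γ₀) (f : A[X]) (n : ℕ) (γ : Γ) :
    v (DirectSum.decompose 𝒜 (f.coeff n) γ : A) ≤ homogGauss 𝒜 v f := by
  rw [← gradedCoaction_coeff, homogGauss_apply]
  refine (le_gaussSup v _ γ).trans ?_
  rw [← gaussVal_coeff_map]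
  exact le_gaussSup _ _ n

theorem exists_eq_homogGauss (v : Valuation A Γ₀) (f : A[X]) :
    ∃ (n : ℕ) (γ : Γ), v (DirectSum.decompose 𝒜 (f.coeff n) γ : A) = homogGauss 𝒜 v f := by
  obtain ⟨n, hn⟩ := exists_eq_gaussSup (gaussVal (M := Γ) v)
    (Polynomial.toFinsuppIso _ (f.map (gradedCoaction 𝒜)))
  rw [gaussVal_coeff_map] at hn
  obtain ⟨γ, hγ⟩ := exists_eq_gaussSup v (gradedCoaction 𝒜 (f.coeff n))
  exact ⟨n, γ, by rw [← gradedCoaction_coeff, hγ, hn, homogGauss_apply]⟩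

end HomogGauss

section Kronecker
open Polynomial
variable {Γ : Type*} [AddCommMonoid Γ] [LinearOrder Γ] [CovariantClass Γ Γ (· + ·) (· < ·)]
variable {A : Type*} [CommRing A] [IsDomain A]
variable {K : Type*} [Field K] [Algebra A K] [IsFractionRing A K]
variable (𝒜 : Γ → AddSubgroup A) [GradedRing 𝒜]

/-- The restriction to `A` of the valuation of a valuation subring of `K`. -/
noncomputable def restrictVal (A : Type*) [CommRing A] [Algebra A K] (U : ValuationSubring K) :
    Valuation A U.ValueGroup :=
  U.valuation.comap (algebraMap A K)

theorem restrictVal_eq_zero (U : ValuationSubring K) {a : A} :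
    restrictVal A U a = 0 ↔ a = 0 := by
  rw [restrictVal, Valuation.comap_apply, map_eq_zero]
  exact map_eq_zero_iff _ (IsFractionRing.injective A K)

theorem eq_zero_of_components {f : A[X]}
    (h : ∀ (n : ℕ) (γ : Γ), (DirectSum.decompose 𝒜 (f.coeff n) γ : A) = 0) : f = 0 := by
  classical
  ext n
  rw [← DirectSum.sum_support_decompose 𝒜 (f.coeff n)]
  simp [h n]

theorem homogGauss_eq_zero (U : ValuationSubring K) {f : A[X]} :
    homogGauss 𝒜 (restrictVal A U) f = 0 ↔ f = 0 := by
  refine ⟨fun h => eq_zero_of_components 𝒜 fun n γ => (restrictVal_eq_zero U).1 ?_,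
    fun h => by rw [h, map_zero]⟩
  exact le_zero_iff.1 (h ▸ le_homogGauss 𝒜 (restrictVal A U) f n γ)

attribute [local instance] Polynomial.algebra isFractionRing_polynomial_ratFunc

/-- The homogeneous Gauss extension to `K(X)` of the valuation of a valuation subring of `K`. -/
noncomputable def kronVal (U : ValuationSubring K) : Valuation (RatFunc K) U.ValueGroup :=
  (homogGauss 𝒜 (restrictVal A U)).extendToLocalization (S := nonZeroDivisors A[X])
    (fun _ hf h => nonZeroDivisors.ne_zero hf ((homogGauss_eq_zero 𝒜 U).1 h)) (RatFunc K)

theorem kronVal_polyToRatFunc (U : ValuationSubring K) (f : A[X]) :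
    kronVal 𝒜 U (polyToRatFunc (K := K) f) = homogGauss 𝒜 (restrictVal A U) f :=
  Valuation.extendToLocalization_apply_map_apply _ _ _ _

theorem polyToRatFunc_ne_zero {f : A[X]} (hf : f ≠ 0) : polyToRatFunc (K := K) f ≠ 0 :=
  (map_ne_zero_iff _ (IsFractionRing.injective A[X] (RatFunc K))).2 hf

theorem exists_polyToRatFunc_eq (A : Type*) [CommRing A] [IsDomain A] [Algebra A K]
    [IsFractionRing A K] (q : RatFunc K) :
    ∃ f g : A[X], g ≠ 0 ∧ q * polyToRatFunc (K := K) g = polyToRatFunc (K := K) f := by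
  obtain ⟨f, g, hg, rfl⟩ := IsFractionRing.div_surjective (A := A[X]) q
  refine ⟨f, g, nonZeroDivisors.ne_zero hg, ?_⟩
  exact div_mul_cancel₀ _ (polyToRatFunc_ne_zero (nonZeroDivisors.ne_zero hg))

theorem kronVal_le_one_iff (U : ValuationSubring K) {q : RatFunc K} {f g : A[X]} (hg : g ≠ 0)
    (h : q * polyToRatFunc (K := K) g = polyToRatFunc (K := K) f) :
    kronVal 𝒜 U q ≤ 1 ↔
      homogGauss 𝒜 (restrictVal A U) f ≤ homogGauss 𝒜 (restrictVal A U) g := by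
  have hg0 : 0 < homogGauss 𝒜 (restrictVal A U) g :=
    zero_lt_iff.2 fun h => hg ((homogGauss_eq_zero 𝒜 U).1 h)
  rw [← kronVal_polyToRatFunc 𝒜 U f, ← h, map_mul, kronVal_polyToRatFunc]
  exact (mul_le_iff_le_one_left hg0).symm

theorem kronVal_lt_one_iff (U : ValuationSubring K) {q : RatFunc K} {f g : A[X]} (hg : g ≠ 0)
    (h : q * polyToRatFunc (K := K) g = polyToRatFunc (K := K) f) :
    kronVal 𝒜 U q < 1 ↔
      homogGauss 𝒜 (restrictVal A U) f < homogGauss 𝒜 (restrictVal A U) g := by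
  have hg0 : 0 < homogGauss 𝒜 (restrictVal A U) g :=
    zero_lt_iff.2 fun h => hg ((homogGauss_eq_zero 𝒜 U).1 h)
  rw [← kronVal_polyToRatFunc 𝒜 U f, ← h, map_mul, kronVal_polyToRatFunc]
  exact (mul_lt_iff_lt_one_left hg0).symm

/-- If `e` has the largest value among the elements of `E`, then `EU = eU`. -/
theorem mem_mulSet_iff {U : ValuationSubring K} (hU : ∀ a : A, algebraMap A K a ∈ U)
    {E : Submodule A K} {e : K} (he : e ∈ E) (hmax : ∀ x ∈ E, U.valuation x ≤ U.valuation e)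
    (z : K) : z ∈ mulSet E (U : Set K) ↔ U.valuation z ≤ U.valuation e := by
  constructor
  · intro hz
    refine Submodule.span_induction ?_ ?_ ?_ ?_ hz
    · rintro _ ⟨x, hx, u, hu, rfl⟩
      rw [map_mul]
      exact (mul_le_of_le_one_right' ((U.valuation_le_one_iff u).2 hu)).trans (hmax x hx)
    · simp
    · intro x y _ _ hx hy
      exact (U.valuation.map_add x y).trans (max_le hx hy)
    · intro a x _ hx
      rw [Algebra.smul_def, map_mul]
      exact (mul_le_of_le_one_left' ((U.valuation_le_one_iff _).2 (hU a))).trans hx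
  · intro hz
    by_cases he0 : e = 0
    · rw [he0, map_zero, le_zero_iff, map_eq_zero] at hz
      rw [hz]; exact zero_mem _
    · refine Submodule.subset_span ⟨e, he, z / e, ?_, (mul_div_cancel₀ z he0).symm⟩
      refine (U.valuation_le_one_iff _).1 ?_
      rw [map_div₀]
      exact div_le_one_of_le₀ hz zero_le

/-- The product of two homogeneous content ideals contains an element of largest value. -/
theorem exists_max_homogContentIdeal {U : ValuationSubring K}
    (hU : ∀ a : A, algebraMap A K a ∈ U) (f h : A[X]) :
    ∃ e ∈ idealToK (K := K) (homogContentIdeal 𝒜 f * homogContentIdeal 𝒜 h),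
      U.valuation e = homogGauss 𝒜 (restrictVal A U) (f * h) ∧
      ∀ x ∈ idealToK (K := K) (homogContentIdeal 𝒜 f * homogContentIdeal 𝒜 h),
        U.valuation x ≤ U.valuation e := by
  have hle (a : A) : restrictVal A U a ≤ 1 := (U.valuation_le_one_iff _).2 (hU a)
  have hcont (f : A[X]) (a : A) (ha : a ∈ homogContentIdeal 𝒜 f) :
      restrictVal A U a ≤ homogGauss 𝒜 (restrictVal A U) f := by
    refine Submodule.span_induction ?_ ?_ ?_ ?_ ha
    · rintro _ ⟨n, γ, rfl⟩
      exact le_homogGauss 𝒜 _ f n γ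
    · simp
    · intro x y _ _ hx hy
      exact ((restrictVal A U).map_add x y).trans (max_le hx hy)
    · intro a x _ hx
      rw [smul_eq_mul, map_mul]
      exact (mul_le_of_le_one_left' (hle a)).trans hx
  obtain ⟨n, γ, hn⟩ := exists_eq_homogGauss 𝒜 (restrictVal A U) f
  obtain ⟨m, δ, hm⟩ := exists_eq_homogGauss 𝒜 (restrictVal A U) h
  have hval : U.valuation (algebraMap A K
      ((DirectSum.decompose 𝒜 (f.coeff n) γ : A) * (DirectSum.decompose 𝒜 (h.coeff m) δ : A))) =
      homogGauss 𝒜 (restrictVal A U) (f * h) := by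
    rw [map_mul, map_mul, map_mul, ← hn, ← hm]
    rfl
  refine ⟨_, ⟨_, Ideal.mul_mem_mul (Ideal.subset_span ⟨n, γ, rfl⟩)
    (Ideal.subset_span ⟨m, δ, rfl⟩), rfl⟩, hval, ?_⟩
  rintro _ ⟨x, hx, rfl⟩
  refine le_trans ?_ hval.ge
  change restrictVal A U x ≤ _
  refine Submodule.mul_induction_on hx (fun a ha b hb => ?_) (fun a b ha hb => ?_)
  · rw [map_mul, map_mul]
    exact mul_le_mul' (hcont f a ha) (hcont h b hb)
  · exact ((restrictVal A U).map_add a b).trans (max_le ha hb)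

theorem idealToK_le_mulSet_iff {U : ValuationSubring K}
    (hU : ∀ a : A, algebraMap A K a ∈ U) (f g h : A[X]) :
    idealToK (K := K) (homogContentIdeal 𝒜 f * homogContentIdeal 𝒜 h) ≤
        mulSet (idealToK (K := K) (homogContentIdeal 𝒜 g * homogContentIdeal 𝒜 h)) (U : Set K) ↔
      homogGauss 𝒜 (restrictVal A U) (f * h) ≤ homogGauss 𝒜 (restrictVal A U) (g * h) := by
  obtain ⟨e, he, hev, hmax⟩ := exists_max_homogContentIdeal 𝒜 hU f h
  obtain ⟨e', he', hev', hmax'⟩ := exists_max_homogContentIdeal 𝒜 hU g h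
  rw [← hev, ← hev']
  refine ⟨fun H => (mem_mulSet_iff hU he' hmax' e).1 (H he), fun H x hx => ?_⟩
  exact (mem_mulSet_iff hU he' hmax' x).2 ((hmax x hx).trans H)

/-- The homogeneous Kronecker function ring, as an intersection of valuation rings. -/
noncomputable def kronRing : Subring (RatFunc K) :=
  ⨅ U : {U : ValuationSubring K // ∀ a : A, algebraMap A K a ∈ U}, (kronVal 𝒜 U.1).integer

theorem mem_kronRing {q : RatFunc K} : q ∈ kronRing (K := K) 𝒜 ↔
    ∀ U : ValuationSubring K, (∀ a : A, algebraMap A K a ∈ U) → kronVal 𝒜 U q ≤ 1 := by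
  simp [kronRing, Subring.mem_iInf, Valuation.mem_integer_iff]

theorem coe_kronRing : (kronRing (K := K) 𝒜 : Set (RatFunc K)) =
    KRSet 𝒜 (bOp : Submodule A K → Submodule A K) := by
  ext q
  rw [SetLike.mem_coe, mem_kronRing]
  constructor
  · intro H
    obtain ⟨f, g, hg, hq⟩ := exists_polyToRatFunc_eq A q
    refine ⟨f, g, 1, hg, one_ne_zero, hq, le_iInf₂ fun U hU => ?_⟩
    rw [idealToK_le_mulSet_iff 𝒜 hU, mul_one, mul_one]
    exact (kronVal_le_one_iff 𝒜 U hg hq).1 (H U hU)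
  · rintro ⟨f, g, h, hg, hh, hq, H⟩ U hU
    have H' := (idealToK_le_mulSet_iff 𝒜 hU f g h).1 (H.trans (iInf₂_le U hU))
    rw [map_mul, map_mul] at H'
    refine (kronVal_le_one_iff 𝒜 U hg hq).2 (le_of_mul_le_mul_right H' ?_)
    exact zero_lt_iff.2 fun h => hh ((homogGauss_eq_zero 𝒜 U).1 h)

end Kronecker

section HomogeneousElements
variable {Γ : Type*} {A : Type*} [CommRing A] {K : Type*} [Field K] [Algebra A K]
variable {𝒜 : Γ → AddSubgroup A}

theorem isHomog_decompose [AddCommMonoid Γ] [DecidableEq Γ] [GradedRing 𝒜] {a : A} {γ : Γ}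
    (h : (DirectSum.decompose 𝒜 a γ : A) ≠ 0) :
    IsHomog 𝒜 (DirectSum.decompose 𝒜 a γ : A) :=
  ⟨h, γ, SetLike.coe_mem _⟩

theorem IsHomog.mul [IsDomain A] [AddCommMonoid Γ] [DecidableEq Γ] [GradedRing 𝒜] {a b : A}
    (ha : IsHomog 𝒜 a) (hb : IsHomog 𝒜 b) : IsHomog 𝒜 (a * b) := by
  obtain ⟨ha0, i, hi⟩ := ha
  obtain ⟨hb0, j, hj⟩ := hb
  exact ⟨mul_ne_zero ha0 hb0, i + j, SetLike.mul_mem_graded hi hj⟩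

theorem IsHomog.one [Nontrivial A] [AddCommMonoid Γ] [DecidableEq Γ] [GradedRing 𝒜] :
    IsHomog 𝒜 (1 : A) :=
  ⟨one_ne_zero, 0, SetLike.one_mem_graded 𝒜⟩

variable [IsDomain A] [IsFractionRing A K]

theorem algebraMap_ne_zero {a : A} (ha : a ≠ 0) : algebraMap A K a ≠ 0 :=
  (map_ne_zero_iff _ (IsFractionRing.injective A K)).2 ha

theorem IsHomogElem.ne_zero {x : K} (hx : IsHomogElem 𝒜 x) : x ≠ 0 := by
  obtain ⟨a, s, ha, hs, h⟩ := hx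
  rintro rfl
  exact algebraMap_ne_zero ha.1 (by rw [← h, zero_mul])

theorem IsHomog.isHomogElem_div {a s : A} (ha : IsHomog 𝒜 a) (hs : IsHomog 𝒜 s) :
    IsHomogElem 𝒜 (algebraMap A K a / algebraMap A K s) :=
  ⟨a, s, ha, hs, div_mul_cancel₀ _ (algebraMap_ne_zero hs.1)⟩

theorem IsHomogElem.exists_div {x : K} (hx : IsHomogElem 𝒜 x) :
    ∃ a s : A, IsHomog 𝒜 a ∧ IsHomog 𝒜 s ∧ x = algebraMap A K a / algebraMap A K s := by
  obtain ⟨a, s, ha, hs, h⟩ := hx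
  exact ⟨a, s, ha, hs, by rw [← h, mul_div_cancel_right₀ _ (algebraMap_ne_zero hs.1)]⟩

theorem IsHomogElem.inv {x : K} (hx : IsHomogElem 𝒜 x) : IsHomogElem 𝒜 x⁻¹ := by
  obtain ⟨a, s, ha, hs, rfl⟩ := hx.exists_div
  rw [inv_div]
  exact hs.isHomogElem_div ha

variable [AddCommMonoid Γ] [DecidableEq Γ] [GradedRing 𝒜]

theorem IsHomog.isHomogElem {a : A} (ha : IsHomog 𝒜 a) : IsHomogElem 𝒜 (algebraMap A K a) :=
  ⟨a, 1, ha, IsHomog.one, by simp⟩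

theorem IsHomogElem.one : IsHomogElem 𝒜 (1 : K) := by
  simpa using (IsHomog.one (𝒜 := 𝒜)).isHomogElem (K := K)

theorem IsHomogElem.mul {x y : K} (hx : IsHomogElem 𝒜 x) (hy : IsHomogElem 𝒜 y) :
    IsHomogElem 𝒜 (x * y) := by
  obtain ⟨a, s, ha, hs, rfl⟩ := hx.exists_div
  obtain ⟨b, t, hb, ht, rfl⟩ := hy.exists_div
  rw [div_mul_div_comm, ← map_mul, ← map_mul]
  exact (ha.mul hb).isHomogElem_div (hs.mul ht)

theorem MemRH.add {x y : K} (hx : MemRH 𝒜 x) (hy : MemRH 𝒜 y) : MemRH 𝒜 (x + y) := by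
  obtain ⟨a, s, hs, h⟩ := hx
  obtain ⟨b, t, ht, h'⟩ := hy
  refine ⟨a * t + b * s, s * t, hs.mul ht, ?_⟩
  rw [map_add, map_mul, map_mul, map_mul, ← h, ← h']
  ring

end HomogeneousElements

section DecomposeMul
variable {Γ : Type*} [AddCommMonoid Γ] [LinearOrder Γ] [CovariantClass Γ Γ (· + ·) (· < ·)]
variable {A : Type*} [CommRing A] (𝒜 : Γ → AddSubgroup A) [GradedRing 𝒜]

theorem decompose_mul_of_mem {s : A} {j : Γ} (hs : s ∈ 𝒜 j) (a : A) (δ : Γ) :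
    (∃ γ, (DirectSum.decompose 𝒜 (a * s) δ : A) = (DirectSum.decompose 𝒜 a γ : A) * s) ∨
      (DirectSum.decompose 𝒜 (a * s) δ : A) = 0 := by
  by_cases hδ : ∃ γ, γ + j = δ
  · obtain ⟨γ, rfl⟩ := hδ
    refine .inl ⟨γ, ?_⟩
    induction a using DirectSum.Decomposition.inductionOn 𝒜 with
    | zero => simp
    | @homogeneous i m =>
      by_cases hi : i = γ
      · subst hi
        rw [DirectSum.decompose_of_mem_same 𝒜 (SetLike.mul_mem_graded m.2 hs),
          DirectSum.decompose_of_mem_same 𝒜 m.2]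
      · have hij : i + j ≠ γ + j := by
          rw [add_comm i, add_comm γ]
          rcases lt_or_gt_of_ne hi with h | h
          · exact (CovariantClass.elim j h).ne
          · exact (CovariantClass.elim j h).ne'
        rw [DirectSum.decompose_of_mem_ne 𝒜 (SetLike.mul_mem_graded m.2 hs) hij,
          DirectSum.decompose_of_mem_ne 𝒜 m.2 hi, zero_mul]
    | add a b ha hb =>
      rw [add_mul, DirectSum.decompose_add, DirectSum.decompose_add, DirectSum.add_apply,
        DirectSum.add_apply, AddSubgroup.coe_add, AddSubgroup.coe_add, ha, hb, add_mul]
  · right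
    induction a using DirectSum.Decomposition.inductionOn 𝒜 with
    | zero => simp
    | @homogeneous i m =>
      exact DirectSum.decompose_of_mem_ne 𝒜 (SetLike.mul_mem_graded m.2 hs) fun h => hδ ⟨i, h⟩
    | add a b ha hb =>
      rw [add_mul, DirectSum.decompose_add, DirectSum.add_apply, AddSubgroup.coe_add, ha, hb,
        add_zero]

end DecomposeMul

section GrValuation
variable {Γ : Type*} [AddCommMonoid Γ] [LinearOrder Γ]
variable {A : Type*} [CommRing A] [IsDomain A]
variable {K : Type*} [Field K] [Algebra A K] [IsFractionRing A K]
variable (𝒜 : Γ → AddSubgroup A) [GradedRing 𝒜]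

/-- The subring of `K` generated by the homogeneous elements of a valuation subring. -/
def homogPart (U : ValuationSubring K) : Subring K :=
  Subring.closure {x : K | x ∈ U ∧ IsHomogElem 𝒜 x}

theorem homogPart_le (U : ValuationSubring K) : homogPart 𝒜 U ≤ U.toSubring :=
  Subring.closure_le.2 fun _ hx => hx.1

theorem mem_homogPart_iff {U : ValuationSubring K} {x : K} (hx : IsHomogElem 𝒜 x) :
    x ∈ homogPart 𝒜 U ↔ x ∈ U :=
  ⟨fun h => homogPart_le 𝒜 U h, fun h => Subring.subset_closure ⟨h, hx⟩⟩

theorem mem_closure_of_mem_homogPart {U : ValuationSubring K} {x : K}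
    (hx : x ∈ homogPart 𝒜 U) : x ∈ AddSubgroup.closure {x : K | x ∈ U ∧ IsHomogElem 𝒜 x} := by
  have h : Submonoid.closure {x : K | x ∈ U ∧ IsHomogElem 𝒜 x} ≤
      { carrier := {x : K | x ∈ U ∧ IsHomogElem 𝒜 x}
        one_mem' := ⟨one_mem U, IsHomogElem.one⟩
        mul_mem' := fun ha hb => ⟨mul_mem ha.1 hb.1, ha.2.mul hb.2⟩ } :=
    Submonoid.closure_le.2 fun _ hx => hx
  exact AddSubgroup.closure_mono h (Subring.mem_closure_iff.1 hx)

theorem isGrValOverring_homogPart {U : ValuationSubring K}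
    (hU : ∀ a : A, algebraMap A K a ∈ U) : IsGrValOverring 𝒜 (homogPart 𝒜 U) := by
  classical
  refine ⟨⟨fun a => ?_, fun x hx => ?_, fun v hv => ?_⟩, fun x hx => ?_⟩
  · rw [← DirectSum.sum_support_decompose 𝒜 a, map_sum]
    refine sum_mem fun γ hγ => ?_
    by_cases h0 : (DirectSum.decompose 𝒜 a γ : A) = 0
    · rw [h0, map_zero]; exact zero_mem _
    · exact Subring.subset_closure ⟨hU _, (isHomog_decompose h0).isHomogElem⟩
  · refine AddSubgroup.closure_induction ?_ ?_ ?_ ?_ (mem_closure_of_mem_homogPart 𝒜 hx)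
    · rintro y ⟨-, a, s, -, hs, h⟩
      exact ⟨a, s, hs, h⟩
    · exact ⟨0, 1, IsHomog.one, by simp⟩
    · exact fun y z _ _ hy hz => hy.add hz
    · rintro y _ ⟨a, s, hs, h⟩
      exact ⟨-a, s, hs, by rw [map_neg, ← h, neg_mul]⟩
  · refine AddSubgroup.closure_mono ?_ (mem_closure_of_mem_homogPart 𝒜 hv)
    exact fun y hy => ⟨Subring.subset_closure hy, hy.2⟩
  · rw [mem_homogPart_iff 𝒜 hx, mem_homogPart_iff 𝒜 hx.inv]
    exact U.mem_or_inv_mem x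

theorem ZarH.ext_homog {V W : ZarH K 𝒜}
    (h : ∀ u : K, IsHomogElem 𝒜 u → (u ∈ V.1 ↔ u ∈ W.1)) : V = W := by
  have key (V W : ZarH K 𝒜) (h : ∀ u : K, IsHomogElem 𝒜 u → (u ∈ V.1 ↔ u ∈ W.1)) :
      V.1 ≤ W.1 := fun x hx => by
    have : AddSubgroup.closure {x : K | x ∈ V.1 ∧ IsHomogElem 𝒜 x} ≤ W.1.toAddSubgroup :=
      (AddSubgroup.closure_le _).2 fun u hu => (h u hu.2).1 hu.1
    exact this (V.2.1.2.2 x hx)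
  exact Subtype.ext (le_antisymm (key V W h) (key W V fun u hu => (h u hu).symm))

variable [CovariantClass Γ Γ (· + ·) (· < ·)]

/-- `x` is zero or a homogeneous nonunit of `V`. -/
def IsHomogNonunit (V : Subring K) (x : K) : Prop :=
  x = 0 ∨ (IsHomogElem 𝒜 x ∧ x ∈ V ∧ x⁻¹ ∉ V)

/-- All the homogeneous components of `z` are zero or nonunits of `V`. -/
def HasNonunitComponents (V : Subring K) (z : K) : Prop :=
  ∃ s a : A, IsHomog 𝒜 s ∧ z * algebraMap A K s = algebraMap A K a ∧
    ∀ γ, IsHomogNonunit 𝒜 V (algebraMap A K (DirectSum.decompose 𝒜 a γ : A) / algebraMap A K s)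

variable {𝒜}

theorem IsHomogNonunit.add {V : Subring K} (hV : IsGrValOverring 𝒜 V) {x y : K}
    (hx : IsHomogNonunit 𝒜 V x) (hy : IsHomogNonunit 𝒜 V y)
    (hxy : x + y = 0 ∨ IsHomogElem 𝒜 (x + y)) : IsHomogNonunit 𝒜 V (x + y) := by
  rcases hxy with h0 | hxy
  · exact .inl h0
  have key {x y : K} (hx : IsHomogElem 𝒜 x) (hxV : x ∈ V) (hxi : x⁻¹ ∉ V) (hyV : y ∈ V)
      (hyx : y / x ∈ V) (hxy : IsHomogElem 𝒜 (x + y)) : IsHomogNonunit 𝒜 V (x + y) := by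
    refine .inr ⟨hxy, add_mem hxV hyV, fun h => hxi ?_⟩
    have hx0 := hx.ne_zero
    have hxy0 := hxy.ne_zero
    have : x⁻¹ = (1 + y / x) * (x + y)⁻¹ := by field_simp
    rw [this]
    exact mul_mem (add_mem (one_mem V) hyx) h
  rcases hx with rfl | ⟨hx, hxV, hxi⟩
  · rwa [zero_add]
  rcases hy with rfl | ⟨hy, hyV, hyi⟩
  · rw [add_zero]; exact .inr ⟨hx, hxV, hxi⟩
  rcases hV.2 (y / x) (by rw [div_eq_mul_inv]; exact hy.mul hx.inv) with h | h
  · exact key hx hxV hxi hyV h hxy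
  · rw [inv_div] at h
    rw [add_comm] at hxy ⊢
    exact key hy hyV hyi hxV h hxy

theorem HasNonunitComponents.add {V : Subring K} (hV : IsGrValOverring 𝒜 V) {x y : K}
    (hx : HasNonunitComponents 𝒜 V x) (hy : HasNonunitComponents 𝒜 V y) :
    HasNonunitComponents 𝒜 V (x + y) := by
  obtain ⟨s, a, hs, hxs, ha⟩ := hx
  obtain ⟨t, b, ht, hyt, hb⟩ := hy
  have key {s t a : A} (hs : IsHomog 𝒜 s) (ht : IsHomog 𝒜 t)
      (ha : ∀ γ, IsHomogNonunit 𝒜 V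
        (algebraMap A K (DirectSum.decompose 𝒜 a γ : A) / algebraMap A K s)) (δ : Γ) :
      IsHomogNonunit 𝒜 V
        (algebraMap A K (DirectSum.decompose 𝒜 (a * t) δ : A) / algebraMap A K (s * t)) := by
    obtain ⟨ht0, j, hj⟩ := ht
    rcases decompose_mul_of_mem 𝒜 hj a δ with ⟨γ, hγ⟩ | h0
    · rw [hγ, map_mul, map_mul, mul_div_mul_right _ _ (algebraMap_ne_zero ht0)]
      exact ha γ
    · rw [h0]; left; simp
  refine ⟨s * t, a * t + b * s, hs.mul ht, ?_, fun δ => ?_⟩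
  · rw [map_add, map_mul, map_mul, map_mul, ← hxs, ← hyt]
    ring
  · have h1 := key hs ht ha δ
    have h2 := key ht hs hb δ
    rw [mul_comm t s] at h2
    have hsum : algebraMap A K (DirectSum.decompose 𝒜 (a * t + b * s) δ : A) /
        algebraMap A K (s * t) =
        algebraMap A K (DirectSum.decompose 𝒜 (a * t) δ : A) / algebraMap A K (s * t) +
        algebraMap A K (DirectSum.decompose 𝒜 (b * s) δ : A) / algebraMap A K (s * t) := by
      rw [DirectSum.decompose_add, DirectSum.add_apply, AddSubgroup.coe_add, map_add, add_div]
    rw [hsum]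
    refine h1.add hV h2 ?_
    rw [← hsum]
    by_cases h0 : (DirectSum.decompose 𝒜 (a * t + b * s) δ : A) = 0
    · left; rw [h0]; simp
    · exact .inr ((isHomog_decompose h0).isHomogElem_div (hs.mul ht))

theorem HasNonunitComponents.zero (V : Subring K) : HasNonunitComponents 𝒜 V (0 : K) :=
  ⟨1, 0, IsHomog.one, by simp, fun γ => .inl (by simp)⟩

theorem HasNonunitComponents.neg {V : Subring K} {x : K}
    (hx : HasNonunitComponents 𝒜 V x) : HasNonunitComponents 𝒜 V (-x) := by
  obtain ⟨s, a, hs, hxs, ha⟩ := hx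
  refine ⟨-s, a, ⟨neg_ne_zero.2 hs.1, ?_⟩, by rw [map_neg, ← hxs]; ring, fun γ => ?_⟩
  · obtain ⟨i, hi⟩ := hs.2
    exact ⟨i, neg_mem hi⟩
  · rw [map_neg, div_neg]
    rcases ha γ with h | ⟨⟨b, t, hb, ht, h⟩, h1, h2⟩
    · left; rw [h, neg_zero]
    · obtain ⟨i, hi⟩ := hb.2
      exact .inr ⟨⟨-b, t, ⟨neg_ne_zero.2 hb.1, i, neg_mem hi⟩, ht, by rw [neg_mul, h, map_neg]⟩,
        neg_mem h1, fun h' => h2 (by rw [inv_neg] at h'; simpa using neg_mem h')⟩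

theorem IsHomogElem.hasNonunitComponents {V : Subring K} {x : K} (hx : IsHomogElem 𝒜 x)
    (hxV : x ∈ V) (hxi : x⁻¹ ∉ V) : HasNonunitComponents 𝒜 V x := by
  obtain ⟨a, s, ha, hs, h⟩ := hx.exists_div
  have hxs : x * algebraMap A K s = algebraMap A K a := by
    rw [h, div_mul_cancel₀ _ (algebraMap_ne_zero hs.1)]
  refine ⟨s, a, hs, hxs, fun γ => ?_⟩
  obtain ⟨ha0, i, hi⟩ := ha
  by_cases hγ : i = γ
  · subst hγ
    rw [DirectSum.decompose_of_mem_same 𝒜 hi, ← h]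
    exact .inr ⟨hx, hxV, hxi⟩
  · rw [DirectSum.decompose_of_mem_ne 𝒜 hi hγ]
    left; simp

theorem not_hasNonunitComponents_one (V : Subring K) : ¬ HasNonunitComponents 𝒜 V (1 : K) := by
  rintro ⟨s, a, hs, h, ha⟩
  rw [one_mul] at h
  obtain rfl := IsFractionRing.injective A K h
  obtain ⟨hs0, i, hi⟩ := hs
  have := ha i
  rw [DirectSum.decompose_of_mem_same 𝒜 hi, div_self (algebraMap_ne_zero hs0)] at this
  rcases this with h | ⟨-, -, h⟩
  · exact one_ne_zero h
  · exact h (by rw [inv_one]; exact one_mem V)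

/-- Every gr-valuation overring has the same homogeneous elements as some valuation overring. -/
theorem exists_valuationSubring_homog {V : Subring K} (hV : IsGrValOverring 𝒜 V) :
    ∃ U : ValuationSubring K, (∀ a : A, algebraMap A K a ∈ U) ∧
      ∀ u : K, IsHomogElem 𝒜 u → (u ∈ U ↔ u ∈ V) := by
  let I : Ideal V := Ideal.span {u : V | IsHomogElem 𝒜 (u : K) ∧ (u : K)⁻¹ ∉ V}
  have hgen {u : K} (hu : IsHomogElem 𝒜 u) (huV : u ∈ V) (hui : u⁻¹ ∉ V) (r : K)
      (hr : r ∈ V) : HasNonunitComponents 𝒜 V (r * u) := by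
    refine AddSubgroup.closure_induction ?_ ?_ ?_ ?_ (hV.1.2.2 r hr)
    · rintro x ⟨hxV, hx⟩
      refine (hx.mul hu).hasNonunitComponents (mul_mem hxV huV) fun h => hui ?_
      have hx0 := hx.ne_zero
      have hu0 := hu.ne_zero
      have : u⁻¹ = x * (x * u)⁻¹ := by field_simp
      rw [this]
      exact mul_mem hxV h
    · rw [zero_mul]; exact HasNonunitComponents.zero V
    · intro x y _ _ hx hy
      rw [add_mul]; exact hx.add hV hy
    · intro x _ hx
      rw [neg_mul]; exact hx.neg
  have hI (z : V) (hz : z ∈ I) : HasNonunitComponents 𝒜 V (z : K) := by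
    suffices h : ∀ r ∈ V, HasNonunitComponents 𝒜 V (r * (z : K)) by
      simpa using h 1 (one_mem V)
    refine Submodule.span_induction
      (p := fun (z : V) _ => ∀ r ∈ V, HasNonunitComponents 𝒜 V (r * (z : K))) ?_ ?_ ?_ ?_ hz
    · rintro x ⟨hx, hxi⟩
      exact hgen hx x.2 hxi
    · intro r _
      rw [ZeroMemClass.coe_zero, mul_zero]
      exact HasNonunitComponents.zero V
    · intro x y _ _ hx hy r hr
      rw [Subring.coe_add, mul_add]
      exact (hx r hr).add hV (hy r hr)
    · intro a x _ hx r hr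
      rw [smul_eq_mul, Subring.coe_mul, ← mul_assoc]
      exact hx _ (mul_mem hr a.2)
  have hI1 : I ≠ ⊤ := fun h =>
    not_hasNonunitComponents_one (𝒜 := 𝒜) V (hI 1 (h ▸ Submodule.mem_top))
  obtain ⟨U, hVU, hIU⟩ := Ideal.image_subset_nonunits_valuationSubring I hI1
  refine ⟨U, fun a => hVU (hV.1.1 a), fun u hu => ⟨fun huU => ?_, fun h => hVU h⟩⟩
  by_contra huV
  have huV' : u⁻¹ ∈ V := (hV.2 u hu).resolve_left huV
  have hmem : (⟨u⁻¹, huV'⟩ : V) ∈ I :=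
    Ideal.subset_span ⟨hu.inv, by rwa [inv_inv]⟩
  have hlt := U.mem_nonunits_iff.1 (hIU ⟨_, hmem, rfl⟩)
  change U.valuation u⁻¹ < 1 at hlt
  rw [map_inv₀, inv_lt_one₀ (zero_lt_iff.2 ((map_ne_zero _).2 hu.ne_zero))] at hlt
  exact hlt.not_ge ((U.valuation_le_one_iff u).2 huU)

end GrValuation

section Center
variable {F : Type*} [Field F]

/-- The center of a valuation on a subring on which its values are at most `1`. -/
def valuationCenter {Γ₀ : Type*} [LinearOrderedCommGroupWithZero Γ₀] (v : Valuation F Γ₀)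
    (S : Subring F) (hS : ∀ x ∈ S, v x ≤ 1) : PrimeSpectrum S where
  asIdeal :=
    { carrier := {x | v (x : F) < 1}
      add_mem' := fun {x y} hx hy => (v.map_add (x : F) y).trans_lt (max_lt hx hy)
      zero_mem' := by simp
      smul_mem' := fun c x hx => by
        change v ((c : F) * x) < 1
        rw [map_mul]
        exact (mul_le_of_le_one_left' (hS c c.2)).trans_lt hx }
  isPrime := by
    refine ⟨fun h => ?_, fun {x y} hxy => ?_⟩
    · have h1 : v ((1 : S) : F) < 1 := (Ideal.eq_top_iff_one _).1 h
      simp at h1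
    · change v ((x : F) * y) < 1 at hxy
      change v (x : F) < 1 ∨ v (y : F) < 1
      by_contra! H
      rw [map_mul] at hxy
      exact hxy.not_ge (one_le_mul H.1 H.2)

/-- Every prime of a subring of a field is the center of a valuation subring. -/
theorem exists_valuationSubring_center (S : Subring F) (P : Ideal S) [P.IsPrime] :
    ∃ B : ValuationSubring F, S ≤ B.toSubring ∧
      ∀ x : S, x ∈ P ↔ B.valuation (x : F) < 1 := by
  have hunit (y : P.primeCompl) : IsUnit (S.subtype y) :=
    IsUnit.mk0 _ fun h => y.2 (by
      have : (y : S) = 0 := Subtype.ext h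
      rw [this]; exact zero_mem P)
  obtain ⟨B, hB, hloc⟩ := IsLocalRing.exists_factor_valuationRing
    (IsLocalization.lift (S := Localization.AtPrime P) hunit)
  have hmem (x : S) : (x : F) ∈ B := by
    have := hB (algebraMap S (Localization.AtPrime P) x)
    rwa [IsLocalization.lift_eq] at this
  refine ⟨B, fun x hx => hmem ⟨x, hx⟩, fun x => ?_⟩
  have hx : (IsLocalization.lift (S := Localization.AtPrime P) hunit).codRestrict
      B.toSubring hB (algebraMap S (Localization.AtPrime P) x) = ⟨x, hmem x⟩ :=
    Subtype.ext (IsLocalization.lift_eq hunit x)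
  have h1 : IsUnit (⟨(x : F), hmem x⟩ : B.toSubring) ↔ x ∉ P := by
    rw [← hx, isUnit_map_iff]
    exact IsLocalization.AtPrime.isUnit_to_map_iff (Localization.AtPrime P) P x
  have h2 : IsUnit (⟨(x : F), hmem x⟩ : B) ↔ x ∉ P := h1
  rw [← not_iff_not, ← h2, B.valuation_eq_one_iff, not_lt]
  exact ⟨fun h => h.ge, fun h => le_antisymm ((B.valuation_le_one_iff _).2 (hmem x)) h⟩

theorem valuationSubring_valuation_le_iff (B : ValuationSubring F) {x y : F} (hy : y ≠ 0) :
    B.valuation x ≤ B.valuation y ↔ x / y ∈ B := by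
  rw [← B.valuation_le_one_iff, map_div₀, div_le_one₀ (zero_lt_iff.2 ((map_ne_zero _).2 hy))]

end Center

section HomogGaussComparison
open Polynomial
variable {Γ : Type*} [AddCommMonoid Γ] [LinearOrder Γ] [CovariantClass Γ Γ (· + ·) (· < ·)]
variable {A : Type*} [CommRing A] [IsDomain A]
variable {K : Type*} [Field K] [Algebra A K] [IsFractionRing A K]
variable (𝒜 : Γ → AddSubgroup A) [GradedRing 𝒜]

theorem homogGauss_le_iff {Γ₀ : Type*} [LinearOrderedCommGroupWithZero Γ₀] (v : Valuation A Γ₀)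
    (f : A[X]) (r : Γ₀) : homogGauss 𝒜 v f ≤ r ↔
      ∀ (n : ℕ) (γ : Γ), v (DirectSum.decompose 𝒜 (f.coeff n) γ : A) ≤ r := by
  refine ⟨fun h n γ => (le_homogGauss 𝒜 v f n γ).trans h, fun h => ?_⟩
  obtain ⟨n, γ, hn⟩ := exists_eq_homogGauss 𝒜 v f
  exact hn ▸ h n γ

theorem forall_decompose_le_iff {Γ₀ : Type*} [LinearOrderedCommGroupWithZero Γ₀]
    (v : Valuation A Γ₀) {a : A} (ha : IsHomog 𝒜 a) (r : Γ₀) :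
    (∀ γ : Γ, v (DirectSum.decompose 𝒜 a γ : A) ≤ r) ↔ v a ≤ r := by
  obtain ⟨-, i, hi⟩ := ha
  refine ⟨fun h => ?_, fun h γ => ?_⟩
  · have := h i
    rwa [DirectSum.decompose_of_mem_same 𝒜 hi] at this
  · by_cases hγ : i = γ
    · subst hγ
      rwa [DirectSum.decompose_of_mem_same 𝒜 hi]
    · rw [DirectSum.decompose_of_mem_ne 𝒜 hi hγ, map_zero]
      exact zero_le

theorem homogGauss_C {Γ₀ : Type*} [LinearOrderedCommGroupWithZero Γ₀] (v : Valuation A Γ₀)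
    {a : A} (ha : IsHomog 𝒜 a) : homogGauss 𝒜 v (C a) = v a := by
  refine eq_of_forall_ge_iff fun r => ?_
  rw [homogGauss_le_iff, ← forall_decompose_le_iff 𝒜 v ha]
  refine ⟨fun h γ => by simpa using h 0 γ, fun h n γ => ?_⟩
  rw [coeff_C]
  split_ifs
  · exact h γ
  · simp

theorem homogGauss_C_add_C_mul_X_le_iff {Γ₀ : Type*} [LinearOrderedCommGroupWithZero Γ₀]
    (v : Valuation A Γ₀) {a s : A} (ha : IsHomog 𝒜 a) (hs : IsHomog 𝒜 s) (r : Γ₀) :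
    homogGauss 𝒜 v (C s + C a * X) ≤ r ↔ v s ≤ r ∧ v a ≤ r := by
  rw [homogGauss_le_iff, ← forall_decompose_le_iff 𝒜 v ha, ← forall_decompose_le_iff 𝒜 v hs]
  refine ⟨fun h => ⟨fun γ => by simpa using h 0 γ, fun γ => by simpa [coeff_C] using h 1 γ⟩, ?_⟩
  rintro ⟨h0, h1⟩ n γ
  match n with
  | 0 => simpa using h0 γ
  | 1 => simpa [coeff_C] using h1 γ
  | n + 2 => simp [coeff_C_succ]

theorem restrictVal_le_iff (U : ValuationSubring K) {c d : A} (hd : d ≠ 0) :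
    restrictVal A U c ≤ restrictVal A U d ↔ algebraMap A K c / algebraMap A K d ∈ U :=
  valuationSubring_valuation_le_iff U (algebraMap_ne_zero hd)

theorem homogGauss_le_homogGauss_iff (U : ValuationSubring K) {f : A[X]} (hf : f ≠ 0)
    (g : A[X]) :
    homogGauss 𝒜 (restrictVal A U) g ≤ homogGauss 𝒜 (restrictVal A U) f ↔
      ∃ (n : ℕ) (γ : Γ), (DirectSum.decompose 𝒜 (f.coeff n) γ : A) ≠ 0 ∧
        ∀ (m : ℕ) (δ : Γ), (DirectSum.decompose 𝒜 (g.coeff m) δ : A) ≠ 0 →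
          algebraMap A K (DirectSum.decompose 𝒜 (g.coeff m) δ : A) /
            algebraMap A K (DirectSum.decompose 𝒜 (f.coeff n) γ : A) ∈ U := by
  constructor
  · intro h
    obtain ⟨n, γ, hn⟩ := exists_eq_homogGauss 𝒜 (restrictVal A U) f
    have h0 : (DirectSum.decompose 𝒜 (f.coeff n) γ : A) ≠ 0 := fun h0 => by
      rw [h0, map_zero] at hn
      exact hf ((homogGauss_eq_zero 𝒜 U).1 hn.symm)
    refine ⟨n, γ, h0, fun m δ _ => ?_⟩
    rw [← restrictVal_le_iff U h0, hn]
    exact (le_homogGauss 𝒜 _ g m δ).trans h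
  · rintro ⟨n, γ, h0, H⟩
    rw [homogGauss_le_iff]
    intro m δ
    by_cases hg0 : (DirectSum.decompose 𝒜 (g.coeff m) δ : A) = 0
    · rw [hg0, map_zero]; exact zero_le
    · exact ((restrictVal_le_iff U h0).2 (H m δ hg0)).trans (le_homogGauss 𝒜 _ f n γ)

theorem kronVal_lt_one_congr {U U' : ValuationSubring K}
    (h : ∀ u : K, IsHomogElem 𝒜 u → (u ∈ U ↔ u ∈ U')) (q : RatFunc K) :
    kronVal 𝒜 U q < 1 ↔ kronVal 𝒜 U' q < 1 := by
  obtain ⟨f, g, hg, hq⟩ := exists_polyToRatFunc_eq A q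
  rw [kronVal_lt_one_iff 𝒜 U hg hq, kronVal_lt_one_iff 𝒜 U' hg hq, ← not_le, ← not_le, not_iff_not]
  by_cases hf : f = 0
  · simp only [hf, map_zero, le_zero_iff, homogGauss_eq_zero]
  rw [homogGauss_le_homogGauss_iff 𝒜 U hf, homogGauss_le_homogGauss_iff 𝒜 U' hf]
  refine exists₂_congr fun n γ => and_congr_right fun h0 => forall₃_congr fun m δ h1 => ?_
  exact h _ ((isHomog_decompose h1).isHomogElem_div (isHomog_decompose h0))

theorem polyToRatFunc_mem_kronRing (f : A[X]) : polyToRatFunc (K := K) f ∈ kronRing 𝒜 := by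
  refine (mem_kronRing 𝒜).2 fun U hU => ?_
  rw [kronVal_polyToRatFunc, homogGauss_le_iff]
  exact fun n γ => (U.valuation_le_one_iff _).2 (hU _)

theorem polyToRatFunc_C (a : A) :
    polyToRatFunc (K := K) (C a) = algebraMap K (RatFunc K) (algebraMap A K a) := by
  simp [polyToRatFunc]

theorem polyToRatFunc_eq_sum (f : A[X]) : polyToRatFunc (K := K) f =
    ∑ n ∈ f.support,
      polyToRatFunc (K := K) (C (f.coeff n)) * polyToRatFunc (K := K) (X ^ n : A[X]) := by
  conv_lhs => rw [f.as_sum_support_C_mul_X_pow]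
  simp only [polyToRatFunc, Polynomial.map_sum, Polynomial.map_mul, map_sum, map_mul]

variable {B : ValuationSubring (RatFunc K)}

theorem valuation_comap_le_iff (x y : K) :
    (B.comap (algebraMap K (RatFunc K))).valuation x ≤
        (B.comap (algebraMap K (RatFunc K))).valuation y ↔
      B.valuation (algebraMap K (RatFunc K) x) ≤ B.valuation (algebraMap K (RatFunc K) y) := by
  by_cases hy : y = 0
  · simp only [hy, map_zero, le_zero_iff, map_eq_zero]
  rw [valuationSubring_valuation_le_iff _ hy,
    valuationSubring_valuation_le_iff _ ((_root_.map_ne_zero (algebraMap K (RatFunc K))).2 hy),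
    ← map_div₀, ValuationSubring.mem_comap]

/-- A valuation overring of the Kronecker function ring is determined by its restriction to `K`:
the value of a polynomial is the value of a dominating component. -/
theorem valuation_polyToRatFunc (hB : kronRing 𝒜 ≤ B.toSubring) {f : A[X]} {n : ℕ} {γ : Γ}
    (h : restrictVal A (B.comap (algebraMap K (RatFunc K)))
        (DirectSum.decompose 𝒜 (f.coeff n) γ : A) =
      homogGauss 𝒜 (restrictVal A (B.comap (algebraMap K (RatFunc K)))) f) :
    B.valuation (polyToRatFunc (K := K) f) =
      B.valuation (polyToRatFunc (K := K) (C (DirectSum.decompose 𝒜 (f.coeff n) γ : A))) := by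
  classical
  set c : A := (DirectSum.decompose 𝒜 (f.coeff n) γ : A) with hc
  have hpoly (p : A[X]) : B.valuation (polyToRatFunc (K := K) p) ≤ 1 :=
    (B.valuation_le_one_iff _).2 (hB (polyToRatFunc_mem_kronRing 𝒜 p))
  apply le_antisymm
  · rw [polyToRatFunc_eq_sum f]
    refine Valuation.map_sum_le _ fun m _ => ?_
    rw [map_mul]
    refine (mul_le_of_le_one_right' (hpoly _)).trans ?_
    rw [polyToRatFunc_C, polyToRatFunc_C, ← DirectSum.sum_support_decompose 𝒜 (f.coeff m), map_sum,
      map_sum]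
    refine Valuation.map_sum_le _ fun δ _ => ?_
    rw [← valuation_comap_le_iff]
    change restrictVal A _ _ ≤ restrictVal A _ c
    rw [h]
    exact le_homogGauss 𝒜 _ f m δ
  · by_cases hf : f = 0
    · simp [hc, hf]
    have hf0 := polyToRatFunc_ne_zero (K := K) hf
    by_cases hc0 : c = 0
    · simp [hc0, polyToRatFunc]
    rw [valuationSubring_valuation_le_iff _ hf0]
    refine hB ((mem_kronRing 𝒜).2 fun U hU => ?_)
    rw [kronVal_le_one_iff 𝒜 U hf (div_mul_cancel₀ _ hf0), homogGauss_C 𝒜 _ (isHomog_decompose hc0)]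
    exact le_homogGauss 𝒜 _ f n γ

theorem valuation_lt_one_iff_kronVal (hB : kronRing 𝒜 ≤ B.toSubring) (q : RatFunc K) :
    B.valuation q < 1 ↔ kronVal 𝒜 (B.comap (algebraMap K (RatFunc K))) q < 1 := by
  obtain ⟨f, g, hg, hq⟩ := exists_polyToRatFunc_eq A q
  have hg0 : 0 < B.valuation (polyToRatFunc (K := K) g) :=
    zero_lt_iff.2 ((_root_.map_ne_zero _).2 (polyToRatFunc_ne_zero hg))
  rw [kronVal_lt_one_iff 𝒜 _ hg hq, ← mul_lt_iff_lt_one_left hg0, ← map_mul, hq]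
  obtain ⟨n, γ, hn⟩ := exists_eq_homogGauss 𝒜
    (restrictVal A (B.comap (algebraMap K (RatFunc K)))) f
  obtain ⟨m, δ, hm⟩ := exists_eq_homogGauss 𝒜
    (restrictVal A (B.comap (algebraMap K (RatFunc K)))) g
  rw [valuation_polyToRatFunc 𝒜 hB hn, valuation_polyToRatFunc 𝒜 hB hm, ← hn, ← hm,
    polyToRatFunc_C, polyToRatFunc_C, ← not_le, ← not_le, not_iff_not]
  exact (valuation_comap_le_iff _ _).symm

end HomogGaussComparison

section Homeomorphism
open Polynomial Topology
variable {Γ : Type*} [AddCommMonoid Γ] [LinearOrder Γ] [CovariantClass Γ Γ (· + ·) (· < ·)]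
variable {A : Type*} [CommRing A] [IsDomain A]
variable {K : Type*} [Field K] [Algebra A K] [IsFractionRing A K]
variable (𝒜 : Γ → AddSubgroup A) [GradedRing 𝒜]

/-- A valuation overring with the same homogeneous elements as a gr-valuation overring. -/
noncomputable def ZarH.extension (V : ZarH K 𝒜) : ValuationSubring K :=
  (exists_valuationSubring_homog V.2).choose

theorem ZarH.algebraMap_mem_extension (V : ZarH K 𝒜) (a : A) :
    algebraMap A K a ∈ ZarH.extension 𝒜 V :=
  (exists_valuationSubring_homog V.2).choose_spec.1 a

theorem ZarH.mem_extension_iff (V : ZarH K 𝒜) {u : K} (hu : IsHomogElem 𝒜 u) :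
    u ∈ ZarH.extension 𝒜 V ↔ u ∈ V.1 :=
  (exists_valuationSubring_homog V.2).choose_spec.2 u hu

/-- The center on the Kronecker function ring of the homogeneous Gauss extension of a
gr-valuation overring. -/
noncomputable def kronCenter (V : ZarH K 𝒜) : PrimeSpectrum (kronRing (K := K) 𝒜) :=
  valuationCenter (kronVal 𝒜 (ZarH.extension 𝒜 V)) (kronRing 𝒜) fun _ hq =>
    (mem_kronRing 𝒜).1 hq _ (ZarH.algebraMap_mem_extension 𝒜 V)

theorem mem_kronCenter (V : ZarH K 𝒜) (q : kronRing (K := K) 𝒜) :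
    q ∈ (kronCenter 𝒜 V).asIdeal ↔ kronVal 𝒜 (ZarH.extension 𝒜 V) (q : RatFunc K) < 1 :=
  Iff.rfl

theorem isOpen_setOf_mem {u : K} (hu : IsHomogElem 𝒜 u) :
    IsOpen {V : ZarH K 𝒜 | u ∈ V.1} :=
  TopologicalSpace.isOpen_generateFrom_of_mem ⟨u, hu, rfl⟩

theorem continuous_kronCenter : Continuous (kronCenter (K := K) 𝒜) := by
  classical
  refine PrimeSpectrum.isTopologicalBasis_basic_opens.continuous_iff.2 ?_
  rintro _ ⟨q, rfl⟩
  obtain ⟨f, g, hg, hq⟩ := exists_polyToRatFunc_eq A (q : RatFunc K)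
  have hmem (V : ZarH K 𝒜) : V ∈ kronCenter 𝒜 ⁻¹' (PrimeSpectrum.basicOpen q) ↔
      homogGauss 𝒜 (restrictVal A (ZarH.extension 𝒜 V)) g ≤
        homogGauss 𝒜 (restrictVal A (ZarH.extension 𝒜 V)) f := by
    rw [← not_lt, ← kronVal_lt_one_iff 𝒜 _ hg hq, ← mem_kronCenter]
    rfl
  by_cases hf : f = 0
  · convert isOpen_empty
    refine Set.eq_empty_of_forall_notMem fun V hV => hg ?_
    rw [hmem, hf, map_zero, le_zero_iff] at hV
    exact (homogGauss_eq_zero 𝒜 _).1 hV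
  have heq : kronCenter 𝒜 ⁻¹' (PrimeSpectrum.basicOpen q) =
      ⋃ (n : ℕ) (γ : Γ) (_ : (DirectSum.decompose 𝒜 (f.coeff n) γ : A) ≠ 0),
        ⋂ m ∈ g.support, ⋂ δ ∈ (DirectSum.decompose 𝒜 (g.coeff m)).support,
          {V : ZarH K 𝒜 | algebraMap A K (DirectSum.decompose 𝒜 (g.coeff m) δ : A) /
            algebraMap A K (DirectSum.decompose 𝒜 (f.coeff n) γ : A) ∈ V.1} := by
    ext V
    rw [hmem, homogGauss_le_homogGauss_iff 𝒜 _ hf]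
    simp only [Set.mem_iUnion, Set.mem_iInter, exists_prop]
    refine exists₂_congr fun n γ => and_congr_right fun h0 => ?_
    constructor
    · intro H m _ δ hδ
      have h1 : (DirectSum.decompose 𝒜 (g.coeff m) δ : A) ≠ 0 := by
        simpa using DFinsupp.mem_support_iff.1 hδ
      exact (ZarH.mem_extension_iff 𝒜 V
        ((isHomog_decompose h1).isHomogElem_div (isHomog_decompose h0))).1 (H m δ h1)
    · intro H m δ h1
      refine (ZarH.mem_extension_iff 𝒜 V
        ((isHomog_decompose h1).isHomogElem_div (isHomog_decompose h0))).2 (H m ?_ δ ?_)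
      · rw [mem_support_iff]
        rintro h
        exact h1 (by simp [h])
      · exact DFinsupp.mem_support_iff.2 fun h => h1 (by simp [h])
  rw [heq]
  refine isOpen_iUnion fun n => isOpen_iUnion fun γ => isOpen_iUnion fun h0 =>
    isOpen_biInter_finset fun m _ => isOpen_biInter_finset fun δ hδ => isOpen_setOf_mem 𝒜 ?_
  have h1 : (DirectSum.decompose 𝒜 (g.coeff m) δ : A) ≠ 0 := by
    simpa using DFinsupp.mem_support_iff.1 hδ
  exact (isHomog_decompose h1).isHomogElem_div (isHomog_decompose h0)

theorem exists_mem_kronCenter_iff {u : K} (hu : IsHomogElem 𝒜 u) :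
    ∃ q : kronRing (K := K) 𝒜, ∀ V : ZarH K 𝒜, q ∉ (kronCenter 𝒜 V).asIdeal ↔ u ∈ V.1 := by
  obtain ⟨a, s, ha, hs, rfl⟩ := hu.exists_div
  have hg : C s + C a * X ≠ 0 := fun h => hs.1 (by simpa using congrArg (coeff · 0) h)
  have hg0 := polyToRatFunc_ne_zero (K := K) hg
  have hq := div_mul_cancel₀ (polyToRatFunc (K := K) (C s)) hg0
  refine ⟨⟨polyToRatFunc (C s) / polyToRatFunc (C s + C a * X),
    (mem_kronRing 𝒜).2 fun U hU => ?_⟩, fun V => ?_⟩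
  · rw [kronVal_le_one_iff 𝒜 U hg hq, homogGauss_C 𝒜 _ hs]
    exact ((homogGauss_C_add_C_mul_X_le_iff 𝒜 _ ha hs _).1 le_rfl).1
  · rw [mem_kronCenter, kronVal_lt_one_iff 𝒜 _ hg hq, not_lt, homogGauss_C 𝒜 _ hs,
      homogGauss_C_add_C_mul_X_le_iff 𝒜 _ ha hs, ← ZarH.mem_extension_iff 𝒜 V hu,
      ← restrictVal_le_iff _ hs.1]
    exact and_iff_right le_rfl

theorem isInducing_kronCenter : IsInducing (kronCenter (K := K) 𝒜) := by
  refine ⟨le_antisymm (continuous_kronCenter 𝒜).le_induced (le_generateFrom ?_)⟩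
  rintro _ ⟨u, hu, rfl⟩
  obtain ⟨q, hq⟩ := exists_mem_kronCenter_iff 𝒜 hu
  exact isOpen_induced_iff.2 ⟨PrimeSpectrum.basicOpen q, (PrimeSpectrum.basicOpen q).2,
    Set.ext hq⟩

theorem kronCenter_injective : Function.Injective (kronCenter (K := K) 𝒜) := by
  intro V W h
  refine ZarH.ext_homog 𝒜 fun u hu => ?_
  obtain ⟨q, hq⟩ := exists_mem_kronCenter_iff 𝒜 hu
  rw [← hq, ← hq, h]

theorem kronCenter_surjective : Function.Surjective (kronCenter (K := K) 𝒜) := by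
  intro P
  obtain ⟨B, hB, hP⟩ := exists_valuationSubring_center (kronRing (K := K) 𝒜) P.asIdeal
  have hU (a : A) : algebraMap A K a ∈ B.comap (algebraMap K (RatFunc K)) := by
    rw [ValuationSubring.mem_comap, ← polyToRatFunc_C]
    exact hB (polyToRatFunc_mem_kronRing 𝒜 _)
  refine ⟨⟨homogPart 𝒜 _, isGrValOverring_homogPart 𝒜 hU⟩,
    PrimeSpectrum.ext (Ideal.ext fun q => ?_)⟩
  rw [mem_kronCenter, hP, valuation_lt_one_iff_kronVal 𝒜 hB]
  refine kronVal_lt_one_congr 𝒜 (fun u hu => ?_) _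
  rw [ZarH.mem_extension_iff 𝒜 _ hu, mem_homogPart_iff 𝒜 hu]

/-- The homeomorphism between the space of gr-valuation overrings and the spectrum of the
homogeneous Kronecker function ring. -/
noncomputable def kronCenterHomeomorph : ZarH K 𝒜 ≃ₜ PrimeSpectrum (kronRing (K := K) 𝒜) :=
  (Equiv.ofBijective _ ⟨kronCenter_injective 𝒜, kronCenter_surjective 𝒜⟩).toHomeomorphOfIsInducing
    (isInducing_kronCenter 𝒜)

theorem isSpectralSpace_of_homeomorph {X Y : Type*} [TopologicalSpace X] [TopologicalSpace Y]
    [SpectralSpace Y] (e : X ≃ₜ Y) : IsSpectralSpace X := by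
  have := e.symm.compactSpace
  have := e.isOpenEmbedding.spectralSpace
  exact ⟨inferInstance, inferInstance, inferInstance, QuasiSeparatedSpace.inter_isCompact,
    PrespectralSpace.isTopologicalBasis⟩

end Homeomorphism

section ZarSpaces
variable {Γ : Type*} [AddCommMonoid Γ] [LinearOrder Γ]
  [CovariantClass Γ Γ (· + ·) (· < ·)] [Nontrivial Γ]
  {A : Type*} [CommRing A] [IsDomain A]
  (K : Type*) [Field K] [Algebra A K] [IsFractionRing A K]
  (𝒜 : Γ → AddSubgroup A) [GradedRing 𝒜]

/-- `Zar_h(R)` is homeomorphic to `Spec(KR(R,b))` (with the Zariski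
topologies); in particular `Zar_h(R)` is a spectral space.  Here `KR(R,b)`, the
homogeneous Kronecker function ring of `R` with respect to the `b`-operation, is
realized as the subring of `K(X)` whose carrier is the set `KRSet 𝒜 bOp`. -/
theorem zarH_spectral :
    ∃ S : Subring (RatFunc K),
      (S : Set (RatFunc K)) = KRSet 𝒜 (bOp : Submodule A K → Submodule A K) ∧
      Nonempty (ZarH K 𝒜 ≃ₜ PrimeSpectrum ↥S) ∧ IsSpectralSpace (ZarH K 𝒜) := by
  exact ⟨kronRing 𝒜, coe_kronRing 𝒜, ⟨kronCenterHomeomorph 𝒜⟩,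
    isSpectralSpace_of_homeomorph (kronCenterHomeomorph 𝒜)⟩

end ZarSpaces
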